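/- Let S ⊆ ℝⁿ be nonempty, compact and Zariski dense, let Φ : ℝ[X₁,…,Xₙ] → ℝ[X₁,…,Xₙ] be an S-nonnegativity preserver, and let (μ_x)_{x∈S} be a family of nonnegative finite Borel measures on S with Φ(p)(x) = ∫_S p dμ_x for all polynomials p and all x ∈ S. Let T : C(S,ℝ) → C(S,ℝ) be a continuous linear operator extending Φ, i.e., T applied to the restriction of any polynomial p to S equals the restriction of Φ(p) to S. Then T is a compact operator if and only if the family of functions {x ↦ μ_x(A) : A ⊆ S Borel} is equicontinuous on S. -/

import Mathlib

open MvPolynomial MeasureTheory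

/-- The restriction of a polynomial to `S`, as a continuous function on `S`. -/
noncomputable def polyRestrict (n : ℕ) (S : Set (Fin n → ℝ))
    (p : MvPolynomial (Fin n) ℝ) : C(S, ℝ) :=
  ⟨fun x => MvPolynomial.eval (x : Fin n → ℝ) p,
    (MvPolynomial.continuous_eval p).comp continuous_subtype_val⟩

/-- A compact set of continuous functions on a topological space is equicontinuous. -/
theorem equicontinuous_of_isCompact {X : Type*} [TopologicalSpace X] [LocallyCompactSpace X]
    {K : Set C(X, ℝ)} (hK : IsCompact K) :
    Equicontinuous (fun (f : K) (x : X) => (f : C(X, ℝ)) x) := by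
  intro x₀
  rw [Metric.equicontinuousAt_iff_right]
  intro ε hε
  obtain ⟨v, hv, h⟩ := hK.mem_uniformity_of_prod (f := fun (x : X) (f : C(X, ℝ)) => f x)
    (s := Set.univ) (q := x₀) (u := {p | dist p.1 p.2 < ε})
    (by
      have : Continuous fun p : X × C(X, ℝ) => p.2 p.1 := by fun_prop
      exact this.continuousOn) (Set.mem_univ _) (Metric.dist_mem_uniformity hε)
  rw [nhdsWithin_univ] at hv
  filter_upwards [hv] with x hx f
  rw [dist_comm]
  exact h x hx f f.2

/-- If two finite measures agree up to `δ` on all measurable sets, then the integrals of a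
measurable function with values in `[0, 1]` agree up to `δ`. -/
theorem abs_integral_sub_integral_le {X : Type*} [MeasurableSpace X]
    {μ ν : Measure X} [IsFiniteMeasure μ] [IsFiniteMeasure ν] {δ : ℝ}
    (h : ∀ A, MeasurableSet A → |μ.real A - ν.real A| ≤ δ) {f : X → ℝ} (hf : Measurable f)
    (h0 : ∀ x, 0 ≤ f x) (h1 : ∀ x, f x ≤ 1) : |∫ x, f x ∂μ - ∫ x, f x ∂ν| ≤ δ := by
  have hint : ∀ (ρ : Measure X) [IsFiniteMeasure ρ], Integrable f ρ := fun ρ _ =>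
    Integrable.of_bound hf.aestronglyMeasurable 1 (.of_forall fun x => by
      rw [Real.norm_eq_abs, abs_of_nonneg (h0 x)]; exact h1 x)
  have hcake : ∀ (ρ : Measure X) [IsFiniteMeasure ρ],
      ∫ x, f x ∂ρ = ∫ t in Set.Ioc 0 1, ρ.real {a | t ≤ f a} := fun ρ _ =>
    (hint ρ).integral_eq_integral_Ioc_meas_le (.of_forall h0) (.of_forall h1)
  have hlevel : ∀ (ρ : Measure X) [IsFiniteMeasure ρ],
      IntegrableOn (fun t : ℝ => ρ.real {a | t ≤ f a}) (Set.Ioc 0 1) := by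
    intro ρ _
    have hanti : Antitone fun t : ℝ => ρ.real {a | t ≤ f a} := fun s t hst =>
      measureReal_mono fun a (ha : t ≤ f a) => hst.trans ha
    exact (hanti.antitoneOn _).integrableOn_isCompact isCompact_Icc |>.mono_set
      Set.Ioc_subset_Icc_self
  rw [hcake μ, hcake ν, ← integral_sub (hlevel μ) (hlevel ν), ← Real.norm_eq_abs]
  refine (norm_setIntegral_le_of_norm_le_const (C := δ) (by simp) fun t _ => ?_).trans (by simp)
  exact h _ (measurableSet_le measurable_const hf)

/-- For every measurable set and every finite measure on a metrizable space, the indicator of the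
set is close in `L¹` to a continuous function with values in `[0, 1]`. -/
theorem exists_continuousMap_integral_indicator_sub_le {X : Type*} [TopologicalSpace X]
    [TopologicalSpace.PseudoMetrizableSpace X] [MeasurableSpace X] [BorelSpace X]
    (μ : Measure X) [IsFiniteMeasure μ] {A : Set X} (hA : MeasurableSet A) {ε : ℝ} (hε : 0 < ε) :
    ∃ g : C(X, ℝ), (∀ x, 0 ≤ g x) ∧ (∀ x, g x ≤ 1) ∧
      ∫ x, |A.indicator 1 x - g x| ∂μ ≤ ε := by
  let := TopologicalSpace.pseudoMetrizableSpacePseudoMetric X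
  have hind : Integrable (A.indicator (1 : X → ℝ)) μ := (integrable_const (1 : ℝ)).indicator hA
  obtain ⟨g, hg, hgi⟩ := hind.exists_boundedContinuous_integral_sub_le hε
  refine ⟨⟨fun x => max 0 (min (g x) 1), by fun_prop⟩, fun x => by simp, fun x => by simp, ?_⟩
  refine le_trans (integral_mono_of_nonneg (.of_forall fun x => abs_nonneg _)
    (hind.sub hgi).norm (.of_forall fun x => ?_)) hg
  simp only [ContinuousMap.coe_mk, Pi.sub_apply, Real.norm_eq_abs]
  have hval : max 0 (min (A.indicator (1 : X → ℝ) x) 1) = A.indicator 1 x := by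
    by_cases hx : x ∈ A <;> simp [hx]
  calc |A.indicator 1 x - max 0 (min (g x) 1)|
      = |max 0 (min (A.indicator (1 : X → ℝ) x) 1) - max 0 (min (g x) 1)| := by rw [hval]
    _ ≤ |min (A.indicator (1 : X → ℝ) x) 1 - min (g x) 1| := by
        simpa using abs_max_sub_max_le_max 0 (min (A.indicator (1 : X → ℝ) x) 1) 0 (min (g x) 1)
    _ ≤ |A.indicator 1 x - g x| := by
        simpa using abs_min_sub_min_le_max (A.indicator (1 : X → ℝ) x) 1 (g x) 1

/-- An operator on `C(X, ℝ)` given by integration against a family of finite measures is compact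
if and only if the evaluations of the family on measurable sets are equicontinuous. -/
theorem isCompactOperator_iff_equicontinuous_measureReal {X : Type*} [TopologicalSpace X]
    [CompactSpace X] [TopologicalSpace.MetrizableSpace X] [MeasurableSpace X] [BorelSpace X]
    (ν : X → Measure X) [∀ x, IsFiniteMeasure (ν x)] (T : C(X, ℝ) →L[ℝ] C(X, ℝ))
    (hT : ∀ f x, T f x = ∫ y, f y ∂(ν x)) :
    IsCompactOperator T ↔
      Equicontinuous (fun (A : {A : Set X // MeasurableSet A}) (x : X) => (ν x).real A) := by
  have hint : ∀ (g : C(X, ℝ)) (ρ : Measure X) [IsFiniteMeasure ρ], Integrable g ρ :=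
    fun g ρ _ => g.continuous.integrable_of_hasCompactSupport (.of_compactSpace _)
  constructor
  · intro h x₀
    obtain ⟨K, hK, hTK⟩ := h.image_closedBall_subset_compact 1
    have hequi := equicontinuous_of_isCompact hK x₀
    rw [Metric.equicontinuousAt_iff_right] at hequi ⊢
    intro ε hε
    filter_upwards [hequi (ε / 4) (by positivity)] with x hx A
    obtain ⟨g, hg0, hg1, hg⟩ := exists_continuousMap_integral_indicator_sub_le
      (ν x₀ + ν x) A.2 (ε := ε / 4) (by positivity)
    have hgK : T g ∈ K := hTK ⟨g, by
      rw [mem_closedBall_zero_iff, ContinuousMap.norm_le _ zero_le_one]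
      exact fun y => by rw [Real.norm_eq_abs, abs_of_nonneg (hg0 y)]; exact hg1 y, rfl⟩
    have hind : ∀ (ρ : Measure X) [IsFiniteMeasure ρ],
        Integrable (A.1.indicator (1 : X → ℝ)) ρ :=
      fun ρ _ => (integrable_const (1 : ℝ)).indicator A.2
    have hdiff : ∀ (ρ : Measure X) [IsFiniteMeasure ρ],
        Integrable (fun y => |A.1.indicator (1 : X → ℝ) y - g y|) ρ :=
      fun ρ _ => ((hind ρ).sub (hint g ρ)).norm
    have happrox : ∀ (ρ : Measure X) [IsFiniteMeasure ρ],
        |ρ.real A - ∫ y, g y ∂ρ| ≤ ∫ y, |A.1.indicator (1 : X → ℝ) y - g y| ∂ρ := by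
      intro ρ _
      rw [← integral_indicator_one A.2, ← integral_sub (hind ρ) (hint g ρ)]
      exact abs_integral_le_integral_abs
    rw [integral_add_measure (hdiff _) (hdiff _)] at hg
    have h₀ := happrox (ν x₀)
    have h₁ := happrox (ν x)
    have hTg := hx ⟨T g, hgK⟩
    have hnn : ∀ ρ : Measure X, 0 ≤ ∫ y, |A.1.indicator (1 : X → ℝ) y - g y| ∂ρ :=
      fun ρ => integral_nonneg fun y => abs_nonneg _
    have hn₀ := hnn (ν x₀)
    have hn₁ := hnn (ν x)
    simp only [hT, Real.dist_eq] at hTg ⊢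
    rw [abs_lt] at hTg ⊢
    rw [abs_le] at h₀ h₁
    constructor <;> linarith
  · intro h
    refine (isCompactOperator_iff_isCompact_closure_image_closedBall
      (T : C(X, ℝ) →ₗ[ℝ] C(X, ℝ)) zero_lt_one).2 ?_
    let e := ContinuousMap.isometryEquivBoundedOfCompact X ℝ
    have hequi : Equicontinuous
        (fun (f : e '' (T '' Metric.closedBall 0 1)) (x : X) =>
          (f : BoundedContinuousFunction X ℝ) x) := by
      intro x₀
      have h₀ := h x₀
      rw [Metric.equicontinuousAt_iff_right] at h₀ ⊢
      intro ε hε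
      filter_upwards [h₀ (ε / 4) (by positivity)] with x hx
      rintro ⟨_, _, ⟨f, hf, rfl⟩, rfl⟩
      rw [mem_closedBall_zero_iff, ContinuousMap.norm_le _ zero_le_one] at hf
      simp only [Real.norm_eq_abs, abs_le] at hf
      have hsets : ∀ A, MeasurableSet A → |(ν x₀).real A - (ν x).real A| ≤ ε / 4 :=
        fun A hA => (hx ⟨A, hA⟩).le
      have hmain := abs_integral_sub_integral_le hsets (f := fun y => (f y + 1) / 2)
        (by fun_prop) (fun y => by linarith [(hf y).1]) (fun y => by linarith [(hf y).2])
      have huniv := hsets _ MeasurableSet.univ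
      have hval : ∀ (ρ : Measure X) [IsFiniteMeasure ρ],
          ∫ y, (f y + 1) / 2 ∂ρ = (∫ y, f y ∂ρ + ρ.real Set.univ) / 2 := by
        intro ρ _
        rw [integral_div, integral_add (hint f ρ) (integrable_const _)]
        simp
      rw [hval, hval] at hmain
      change dist (T f x₀) (T f x) < ε
      rw [hT, hT, Real.dist_eq, abs_lt]
      rw [abs_le] at hmain huniv
      constructor <;> linarith
    have hcomp := BoundedContinuousFunction.arzela_ascoli (Metric.closedBall 0 ‖T‖)
      (isCompact_closedBall _ _) (e '' (T '' Metric.closedBall 0 1)) (by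
        rintro _ x ⟨_, ⟨f, hf, rfl⟩, rfl⟩
        rw [mem_closedBall_zero_iff] at hf ⊢
        exact ((T f).norm_coe_le_norm x).trans ((T.le_opNorm f).trans
          (mul_le_of_le_one_right (norm_nonneg _) hf))) hequi
    have := e.toHomeomorph.image_closure (T '' Metric.closedBall 0 1)
    rw [IsometryEquiv.coe_toHomeomorph] at this
    rw [← this] at hcomp
    exact e.toHomeomorph.isCompact_image.1 hcomp

/-- Polynomial functions are dense in the continuous functions on a compact subset of `ℝⁿ`. -/
theorem denseRange_polyRestrict {n : ℕ} {S : Set (Fin n → ℝ)} (hc : IsCompact S) :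
    DenseRange (polyRestrict n S) := by
  have : CompactSpace S := isCompact_iff_compactSpace.1 hc
  let φ : MvPolynomial (Fin n) ℝ →ₐ[ℝ] C(S, ℝ) :=
    { toFun := polyRestrict n S
      map_one' := by ext; simp [polyRestrict]
      map_mul' := fun p q => by ext; simp [polyRestrict]
      map_zero' := by ext; simp [polyRestrict]
      map_add' := fun p q => by ext; simp [polyRestrict]
      commutes' := fun r => by ext; simp [polyRestrict, MvPolynomial.algebraMap_eq] }
  have htop := ContinuousMap.subalgebra_topologicalClosure_eq_top_of_separatesPoints φ.range (by
    intro x y hxy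
    obtain ⟨i, hi⟩ : ∃ i, (x : Fin n → ℝ) i ≠ (y : Fin n → ℝ) i := by
      by_contra! hcon
      exact hxy (Subtype.ext (funext hcon))
    exact ⟨_, ⟨φ (X i), ⟨X i, rfl⟩, rfl⟩, by simpa [φ, polyRestrict] using hi⟩)
  intro f
  have hf : f ∈ φ.range.topologicalClosure := htop ▸ Algebra.mem_top
  exact hf

/-- For nonempty compact Zariski dense `S`, an `S`-nonnegativity preserver `Φ` with
representing family `(μ_x)_{x∈S}`, and a continuous linear extension `T` of `Φ` to
`C(S,ℝ)`: `T` is a compact operator if and only if the family of functions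
`x ↦ μ_x(A)`, indexed by the Borel subsets `A ⊆ S`, is equicontinuous. -/
theorem compact_extension_iff_equicontinuous
    (n : ℕ) (S : Set (Fin n → ℝ)) (hne : S.Nonempty) (hc : IsCompact S)
    (hzar : ∀ p : MvPolynomial (Fin n) ℝ, (∀ x ∈ S, MvPolynomial.eval x p = 0) → p = 0)
    (Φ : MvPolynomial (Fin n) ℝ →ₗ[ℝ] MvPolynomial (Fin n) ℝ)
    (hΦ : ∀ p : MvPolynomial (Fin n) ℝ,
      (∀ x ∈ S, 0 ≤ MvPolynomial.eval x p) → ∀ x ∈ S, 0 ≤ MvPolynomial.eval x (Φ p))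
    (μ : (Fin n → ℝ) → Measure (Fin n → ℝ))
    (hfin : ∀ x ∈ S, IsFiniteMeasure (μ x))
    (hsupp : ∀ x ∈ S, μ x Sᶜ = 0)
    (hrep : ∀ x ∈ S, ∀ p : MvPolynomial (Fin n) ℝ,
      MvPolynomial.eval x (Φ p) = ∫ y, MvPolynomial.eval y p ∂(μ x))
    (T : C(S, ℝ) →L[ℝ] C(S, ℝ))
    (hT : ∀ p : MvPolynomial (Fin n) ℝ, T (polyRestrict n S p) = polyRestrict n S (Φ p)) :
    IsCompactOperator T ↔
      Equicontinuous (fun A : {A : Set (Fin n → ℝ) // MeasurableSet A ∧ A ⊆ S} =>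
        fun x : S => ((μ x) (A : Set (Fin n → ℝ))).toReal) := by
  have : CompactSpace S := isCompact_iff_compactSpace.1 hc
  have hS : MeasurableSet S := hc.isClosed.measurableSet
  have hemb : MeasurableEmbedding (Subtype.val : S → Fin n → ℝ) := .subtype_coe hS
  let ν : S → Measure S := fun x => (μ x).comap Subtype.val
  have hνA : ∀ (x : S) (A : Set S), ν x A = μ x (Subtype.val '' A) :=
    fun x A => hemb.comap_apply _ _
  have hνfin : ∀ x, IsFiniteMeasure (ν x) := fun x => by
    have := hfin x x.2
    exact ⟨by rw [hνA]; exact measure_lt_top _ _⟩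
  have hpoly : ∀ (p : MvPolynomial (Fin n) ℝ) (x : S),
      T (polyRestrict n S p) x = ∫ y, polyRestrict n S p y ∂(ν x) := by
    intro p x
    rw [hT]
    change eval (x : Fin n → ℝ) (Φ p) =
      ∫ y : S, eval (y : Fin n → ℝ) p ∂((μ x).comap Subtype.val)
    rw [hrep x x.2, integral_subtype_comap hS fun y => eval y p,
      Measure.restrict_eq_self_of_ae_mem]
    exact hsupp x x.2
  have hint : ∀ (x : S) (g : C(S, ℝ)), Integrable g (ν x) :=
    fun x g => g.continuous.integrable_of_hasCompactSupport (.of_compactSpace _)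
  have hTν : ∀ f x, T f x = ∫ y, f y ∂(ν x) := by
    intro f x
    have hcont : Continuous fun f : C(S, ℝ) => ∫ y, f y ∂(ν x) :=
      (LipschitzWith.of_dist_le' (K := (ν x).real Set.univ) fun f g => by
        rw [dist_eq_norm, ← integral_sub (hint x f) (hint x g), mul_comm]
        refine norm_integral_le_of_norm_le_const (.of_forall fun y => ?_)
        rw [← dist_eq_norm]
        exact ContinuousMap.dist_apply_le_dist y).continuous
    have hTcont : Continuous fun f : C(S, ℝ) => T f x := by fun_prop
    exact congrFun ((denseRange_polyRestrict hc).equalizer hTcont hcont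
      (_root_.funext fun p => hpoly p x)) f
  rw [isCompactOperator_iff_equicontinuous_measureReal ν T hTν]
  let e : {A : Set S // MeasurableSet A} → {A : Set (Fin n → ℝ) // MeasurableSet A ∧ A ⊆ S} :=
    fun A => ⟨Subtype.val '' A.1, hemb.measurableSet_image.2 A.2, by simp⟩
  have he : Function.Surjective e := fun A => ⟨⟨Subtype.val ⁻¹' A.1, measurable_subtype_coe A.2.1⟩,
    Subtype.ext (by simpa [e] using A.2.2)⟩
  have hval : ∀ A (x : S), (ν x).real A.1 = ((μ x) (e A).1).toReal := fun A x => by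
    rw [measureReal_def, hνA]
  simp_rw [hval]
  exact ⟨fun h x U hU => (h x U hU).mono fun y hy => he.forall.2 hy,
    fun h x U hU => (h x U hU).mono fun y hy A => hy (e A)⟩
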